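/- For every integer d ≥ 2 and every positive integer β, there exists a constant C > 0, independent of n, such that for every n ∈ ℕ, every x ∈ Δ_{d−1}, and all 0 ≤ s ≤ t ≤ 1, the linearly interpolated process satisfies 𝔼[‖𝓗_t^{(n)}(x) − 𝓗_s^{(n)}(x)‖^{2β}] ≤ C·(t − s)^β, where ‖·‖ is the Euclidean norm on ℝ^d. -/

import Mathlib

open Finset Filter MeasureTheory

noncomputable section

/-- Multi-indices `k : Fin d → ℕ` with `|k| = k₁ + ⋯ + k_d = n`. -/
def multiIdx (d n : ℕ) : Finset (Fin d → ℕ) :=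
  (Fintype.piFinset fun _ : Fin d => Finset.range (n + 1)).filter fun k => ∑ i, k i = n

/-- Multinomial weight `n!/(k₁!⋯k_d!) · x₁^{k₁}⋯x_d^{k_d}`. -/
def mWeight {d : ℕ} (x : Fin d → ℝ) (k : Fin d → ℕ) : ℝ :=
  (Nat.multinomial Finset.univ k : ℝ) * ∏ i, x i ^ k i

/-- The Euclidean norm on `Fin d → ℝ`. -/
def eucNorm {d : ℕ} (v : Fin d → ℝ) : ℝ := Real.sqrt (∑ i, v i ^ 2)

/-- The linear interpolation `𝓗_t^{(n)} = H^{⌊nt⌋} + (nt − ⌊nt⌋)(H^{⌊nt⌋+1} − H^{⌊nt⌋})`. -/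
def interp {Ω : Type} {d : ℕ} (H : ℕ → Ω → (Fin d → ℝ)) (n : ℕ) (t : ℝ) (ω : Ω) :
    Fin d → ℝ :=
  H ⌊(n : ℝ) * t⌋₊ ω
    + ((n : ℝ) * t - (⌊(n : ℝ) * t⌋₊ : ℝ)) • (H (⌊(n : ℝ) * t⌋₊ + 1) ω - H ⌊(n : ℝ) * t⌋₊ ω)

lemma aux_multiIdx (d n : ℕ) : multiIdx d n = Finset.piAntidiag Finset.univ n := by
  ext k
  simp only [multiIdx, Finset.mem_filter, Fintype.mem_piFinset, Finset.mem_range,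
    Finset.mem_piAntidiag, Finset.mem_univ, implies_true, and_true, and_iff_right_iff_imp]
  intro h i
  have := Finset.single_le_sum (f := k) (fun j _ => Nat.zero_le _) (Finset.mem_univ i)
  omega

lemma aux_hoeff (y a : ℝ) (h0 : 0 ≤ y) (h1 : y ≤ 1) :
    1 + y * (Real.exp a - 1) ≤ Real.exp (a * y + a ^ 2 / 8) := by
  let μ : Measure ℝ := ENNReal.ofReal y • Measure.dirac 1 + ENNReal.ofReal (1 - y) • Measure.dirac 0
  have hμ : IsProbabilityMeasure μ := by
    constructor
    simp only [μ, Measure.add_apply, Measure.smul_apply, measure_univ, smul_eq_mul, mul_one]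
    rw [← ENNReal.ofReal_add h0 (by linarith)]
    simp
  have hint : ∀ f : ℝ → ℝ, ∫ z, f z ∂μ = y * f 1 + (1 - y) * f 0 := by
    intro f
    have e1 : Integrable f (ENNReal.ofReal y • Measure.dirac (1:ℝ)) :=
      (integrable_dirac (by simp [enorm_lt_top])).smul_measure (by simp)
    have e0 : Integrable f (ENNReal.ofReal (1 - y) • Measure.dirac (0:ℝ)) :=
      (integrable_dirac (by simp [enorm_lt_top])).smul_measure (by simp)
    simp only [μ]
    rw [integral_add_measure e1 e0, integral_smul_measure, integral_smul_measure]
    simp [h0, h1]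
  have hb : ∀ᵐ z ∂μ, z ∈ Set.Icc (0:ℝ) 1 := by
    simp only [μ, ae_add_measure_iff]
    constructor
    · refine Measure.ae_smul_measure ?_ _
      simp [ae_dirac_eq]
    · refine Measure.ae_smul_measure ?_ _
      simp [ae_dirac_eq]
  have h := (ProbabilityTheory.hasSubgaussianMGF_of_mem_Icc (X := fun z : ℝ => z) (μ := μ)
    (a := 0) (b := 1) measurable_id.aemeasurable hb).mgf_le a
  rw [ProbabilityTheory.mgf, hint, hint] at h
  have e : Real.exp (a * y + a ^ 2 / 8) = Real.exp (a * y) * Real.exp (a ^ 2 / 8) :=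
    Real.exp_add _ _
  have h2 := mul_le_mul_of_nonneg_left h (Real.exp_pos (a * y)).le
  rw [e]
  refine le_trans (le_of_eq ?_) (h2.trans (le_of_eq ?_))
  · have e1 : Real.exp (a * (1 - (y * 1 + (1 - y) * 0))) = Real.exp a * (Real.exp (a*y))⁻¹ := by
      rw [← Real.exp_neg, ← Real.exp_add]; congr 1; ring
    have e2 : Real.exp (a * (0 - (y * 1 + (1 - y) * 0))) = (Real.exp (a*y))⁻¹ := by
      rw [← Real.exp_neg]; congr 1; ring
    rw [e1, e2]
    field_simp
    ring
  · congr 2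
    simp
    ring

lemma aux_mgf {d n : ℕ} (hn : 1 ≤ n) (y : Fin d → ℝ) (hy : y ∈ stdSimplex ℝ (Fin d))
    (i : Fin d) (θ : ℝ) :
    ∑ k ∈ multiIdx d n, mWeight y k * Real.exp (θ * ((k i : ℝ) / n))
      ≤ Real.exp (θ * y i + θ ^ 2 / (8 * n)) := by
  have hn' : (0:ℝ) < n := by exact_mod_cast hn
  have h1 : ∑ k ∈ multiIdx d n, mWeight y k * Real.exp (θ * ((k i : ℝ) / n))
      = (∑ j, y j * (if j = i then Real.exp (θ / n) else 1)) ^ n := by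
    rw [Finset.sum_pow_eq_sum_piAntidiag, aux_multiIdx]
    refine Finset.sum_congr rfl fun k _ => ?_
    rw [mWeight, mul_assoc]
    congr 1
    simp_rw [mul_pow]
    rw [Finset.prod_mul_distrib]
    congr 1
    rw [Finset.prod_eq_single i]
    · rw [if_pos rfl, ← Real.exp_nat_mul]; congr 1; ring
    · intro b _ hb; simp [hb]
    · simp
  have h2 : ∑ j, y j * (if j = i then Real.exp (θ / n) else 1)
      = 1 + y i * (Real.exp (θ / n) - 1) := by
    have : ∀ j, y j * (if j = i then Real.exp (θ / n) else 1)
      = y j + (if j = i then y j * (Real.exp (θ / n) - 1) else 0) := by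
      intro j; split_ifs <;> ring
    simp_rw [this, Finset.sum_add_distrib, hy.2]
    simp
  rw [h1, h2]
  have hyi0 := hy.1 i
  have hyi1 : y i ≤ 1 := by
    rw [← hy.2]; exact Finset.single_le_sum (fun j _ => hy.1 j) (Finset.mem_univ i)
  have h3 : 0 ≤ 1 + y i * (Real.exp (θ / n) - 1) := by
    nlinarith [Real.exp_pos (θ / n), mul_nonneg hyi0 (Real.exp_pos (θ / n)).le]
  refine (pow_le_pow_left₀ h3 (aux_hoeff _ _ hyi0 hyi1) n).trans (le_of_eq ?_)
  rw [← Real.exp_nat_mul]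
  congr 1
  field_simp

/-- clamp coefficient -/
def cCoef (z : ℝ) (N : ℕ) : ℝ := max 0 (min 1 (z - N))

lemma aux_interp (u : ℕ → ℝ) (z : ℝ) (hz : 0 ≤ z) (K : ℕ) (hK : ⌊z⌋₊ < K) :
    u ⌊z⌋₊ + (z - (⌊z⌋₊ : ℝ)) * (u (⌊z⌋₊ + 1) - u ⌊z⌋₊)
      = u 0 + ∑ N ∈ Finset.range K, cCoef z N * (u (N + 1) - u N) := by
  have hf := Nat.floor_le hz
  have hf' := Nat.lt_floor_add_one z
  obtain ⟨r, rfl⟩ := Nat.exists_eq_add_of_le hK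
  rw [Finset.sum_range_add, Nat.succ_eq_add_one, Finset.sum_range_succ]
  have e1 : ∑ N ∈ Finset.range ⌊z⌋₊, cCoef z N * (u (N + 1) - u N) = u ⌊z⌋₊ - u 0 := by
    rw [← Finset.sum_range_sub]
    refine Finset.sum_congr rfl fun N hN => ?_
    have : ((N + 1 : ℕ) : ℝ) ≤ ⌊z⌋₊ := by exact_mod_cast Finset.mem_range.1 hN
    push_cast at this
    rw [cCoef, min_eq_left (by linarith), max_eq_right zero_le_one, one_mul]
  have e2 : cCoef z ⌊z⌋₊ = z - ⌊z⌋₊ := by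
    rw [cCoef, min_eq_right (by linarith), max_eq_right (by linarith)]
  have e3 : ∑ N ∈ Finset.range r, cCoef z (⌊z⌋₊ + 1 + N) *
      (u (⌊z⌋₊ + 1 + N + 1) - u (⌊z⌋₊ + 1 + N)) = 0 := by
    refine Finset.sum_eq_zero fun N _ => ?_
    have : (0:ℝ) ≤ N := Nat.cast_nonneg N
    rw [cCoef, max_eq_left, zero_mul]
    refine (min_le_right _ _).trans ?_
    push_cast; linarith
  rw [e1, e2, e3]; ring

lemma cCoef_mono {z w : ℝ} (h : z ≤ w) (N : ℕ) : cCoef z N ≤ cCoef w N := by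
  unfold cCoef; gcongr

lemma cCoef_mem (z : ℝ) (N : ℕ) : 0 ≤ cCoef z N ∧ cCoef z N ≤ 1 := by
  unfold cCoef; exact ⟨le_max_left _ _, max_le zero_le_one (min_le_left _ _)⟩

lemma aux_bdd_integrable {Ω : Type} {m : MeasurableSpace Ω} (μ : Measure Ω)
    [IsProbabilityMeasure μ] (f : Ω → ℝ) (hf : Measurable f) (C : ℝ) (h : ∀ ω, |f ω| ≤ C) :
    Integrable f μ :=
  Integrable.of_bound hf.aestronglyMeasurable C (Eventually.of_forall h)

lemma aux_chain {d n : ℕ} (hn : 1 ≤ n) {Ω : Type} {m : MeasurableSpace Ω} (μ : Measure Ω)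
    [IsProbabilityMeasure μ] (ℱ : Filtration ℕ m) (H : ℕ → Ω → (Fin d → ℝ))
    (hA : Adapted ℱ H) (hS : ∀ N ω, H N ω ∈ stdSimplex ℝ (Fin d))
    (hM : ∀ (N : ℕ) (g : (Fin d → ℝ) → ℝ),
          μ[(fun ω => g (H (N + 1) ω))|ℱ N]
            =ᵐ[μ] fun ω => ∑ k ∈ multiIdx d n, mWeight (H N ω) k * g fun i => (k i : ℝ) / n)
    (i : Fin d) (a : ℕ → ℝ) (K : ℕ) :
    ∫ ω, Real.exp (∑ N ∈ Finset.range K, a N * (H (N + 1) ω i - H N ω i)) ∂μ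
      ≤ Real.exp (∑ N ∈ Finset.range K, (a N) ^ 2 / (8 * n)) := by
  have hb : ∀ N ω, |H N ω i| ≤ 1 := by
    intro N ω
    rw [abs_of_nonneg ((hS N ω).1 i), ← (hS N ω).2]
    exact Finset.single_le_sum (fun j _ => (hS N ω).1 j) (Finset.mem_univ i)
  have hmF : ∀ N, Measurable[ℱ N] (fun ω => H N ω i) := fun N =>
    (measurable_pi_apply i).comp (hA N)
  have hm : ∀ N, Measurable (fun ω => H N ω i) := fun N => (hmF N).mono (ℱ.le N) le_rfl
  have hbD : ∀ N ω, |a N * (H (N + 1) ω i - H N ω i)| ≤ |a N| * 2 := by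
    intro N ω
    rw [abs_mul]
    gcongr
    have := abs_le.1 (hb N ω); have := abs_le.1 (hb (N+1) ω)
    rw [abs_le]; constructor <;> linarith
  have hbS : ∀ K ω, |∑ N ∈ Finset.range K, a N * (H (N + 1) ω i - H N ω i)|
      ≤ ∑ N ∈ Finset.range K, |a N| * 2 := fun K ω =>
    (Finset.abs_sum_le_sum_abs _ _).trans (Finset.sum_le_sum fun N _ => hbD N ω)
  induction K with
  | zero => simp
  | succ K ih =>
    set S : Ω → ℝ := fun ω => ∑ N ∈ Finset.range K, a N * (H (N + 1) ω i - H N ω i) with hSdef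
    have hSm : Measurable[ℱ K] S := by
      refine Finset.measurable_fun_sum _ fun N hN => ?_
      have hNK := Finset.mem_range.1 hN
      have h1 : Measurable[ℱ K] (fun ω => H (N + 1) ω i) := (hmF (N+1)).mono (ℱ.mono hNK) le_rfl
      have h2 : Measurable[ℱ K] (fun ω => H N ω i) := (hmF N).mono (ℱ.mono hNK.le) le_rfl
      exact (h1.sub h2).const_mul _
    let f : Ω → ℝ := fun ω => Real.exp (S ω - a K * H K ω i)
    let g : Ω → ℝ := fun ω => Real.exp (a K * H (K + 1) ω i)
    have hfm : Measurable[ℱ K] f := Real.measurable_exp.comp (hSm.sub ((hmF K).const_mul _))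
    have hgm : Measurable g := Real.measurable_exp.comp ((hm (K+1)).const_mul _)
    have hfg : ∀ ω, Real.exp (∑ N ∈ Finset.range (K+1), a N * (H (N + 1) ω i - H N ω i))
        = (f * g) ω := by
      intro ω
      rw [Finset.sum_range_succ, Pi.mul_apply, ← Real.exp_add]
      congr 1
      simp only [S]; ring
    have hgb : ∀ ω, |g ω| ≤ Real.exp (|a K|) := by
      intro ω
      rw [abs_of_pos (Real.exp_pos _)]
      refine Real.exp_le_exp.2 ((le_abs_self _).trans ?_)
      rw [abs_mul]
      exact mul_le_of_le_one_right (abs_nonneg _) (hb _ _)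
    have hgi : Integrable g μ := aux_bdd_integrable μ g hgm _ hgb
    have hfm' : Measurable f := hfm.mono (ℱ.le K) le_rfl
    have hfgi : Integrable (f * g) μ := by
      refine aux_bdd_integrable μ _ (hfm'.mul hgm)
        (Real.exp (∑ N ∈ Finset.range (K+1), |a N| * 2)) fun ω => ?_
      rw [← hfg, abs_of_pos (Real.exp_pos _)]
      exact Real.exp_le_exp.2 ((le_abs_self _).trans (hbS _ _))
    have hSm' : Measurable S := hSm.mono (ℱ.le K) le_rfl
    have hSi : Integrable (fun ω => Real.exp (S ω)) μ := by
      refine aux_bdd_integrable μ _ (Real.measurable_exp.comp hSm')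
        (Real.exp (∑ N ∈ Finset.range K, |a N| * 2)) fun ω => ?_
      rw [abs_of_pos (Real.exp_pos _)]
      exact Real.exp_le_exp.2 ((le_abs_self _).trans (hbS _ _))
    have hpull := condExp_mul_of_stronglyMeasurable_left (m := ℱ K) (μ := μ)
      hfm.stronglyMeasurable hfgi hgi
    have hle : ∀ᵐ ω ∂μ, (μ[f * g | ℱ K]) ω
        ≤ Real.exp ((a K) ^ 2 / (8 * n)) * Real.exp (S ω) := by
      filter_upwards [hpull, hM K (fun z => Real.exp (a K * z i))] with ω h1 h2
      rw [h1, Pi.mul_apply]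
      have h2' : (μ[g | ℱ K]) ω = _ := h2
      rw [h2']
      refine (mul_le_mul_of_nonneg_left (aux_mgf hn (H K ω) (hS K ω) i (a K))
        (Real.exp_pos _).le).trans (le_of_eq ?_)
      change Real.exp (S ω - a K * H K ω i) * _ = _
      rw [← Real.exp_add, ← Real.exp_add]
      congr 1; ring
    calc ∫ ω, Real.exp (∑ N ∈ Finset.range (K+1), a N * (H (N + 1) ω i - H N ω i)) ∂μ
        = ∫ ω, (f * g) ω ∂μ := integral_congr_ae (Eventually.of_forall hfg)
      _ = ∫ ω, (μ[f * g | ℱ K]) ω ∂μ := (integral_condExp (ℱ.le K)).symm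
      _ ≤ ∫ ω, Real.exp ((a K) ^ 2 / (8 * n)) * Real.exp (S ω) ∂μ :=
          integral_mono_ae integrable_condExp (hSi.const_mul _) hle
      _ = Real.exp ((a K) ^ 2 / (8 * n)) * ∫ ω, Real.exp (S ω) ∂μ := integral_const_mul _ _
      _ ≤ Real.exp ((a K) ^ 2 / (8 * n)) *
          Real.exp (∑ N ∈ Finset.range K, (a N) ^ 2 / (8 * n)) :=
          mul_le_mul_of_nonneg_left ih (Real.exp_pos _).le
      _ = _ := by rw [← Real.exp_add, Finset.sum_range_succ, add_comm]

lemma aux_cosh (β : ℕ) (y : ℝ) :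
    y ^ (2 * β) ≤ ((2 * β).factorial : ℝ) * (Real.exp y + Real.exp (-y)) := by
  have h := Real.pow_div_factorial_le_exp |y| (abs_nonneg y) (2 * β)
  rw [div_le_iff₀ (by positivity), Even.pow_abs (even_two_mul β)] at h
  refine h.trans ?_
  rw [mul_comm]
  gcongr
  rcases abs_cases y with ⟨h, _⟩ | ⟨h, _⟩ <;> rw [h]
  · linarith [Real.exp_pos (-y)]
  · linarith [Real.exp_pos y]

lemma inner_le_card {d : ℕ} (v : Fin d → ℝ) (b : ℕ) :
    (∑ i, v i ^ 2) ^ (b + 1) ≤ (d : ℝ) ^ b * ∑ i, (v i ^ 2) ^ (b + 1) := by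
  simpa using pow_sum_le_card_mul_sum_pow (s := Finset.univ) (f := fun i => v i ^ 2) (fun i _ => sq_nonneg _) b

lemma aux_norm {d β : ℕ} (hβ : 1 ≤ β) (v : Fin d → ℝ) :
    eucNorm v ^ (2 * β) ≤ (d : ℝ) ^ (β - 1) * ∑ i, v i ^ (2 * β) := by
  rw [eucNorm, pow_mul, Real.sq_sqrt (Finset.sum_nonneg fun i _ => sq_nonneg _)]
  obtain ⟨b, rfl⟩ := Nat.exists_eq_add_of_le' hβ
  have := inner_le_card (d := d) v b
  simpa [pow_mul] using this

lemma aux_coord {d n : ℕ} (hn : 1 ≤ n) {Ω : Type} {m : MeasurableSpace Ω} (μ : Measure Ω)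
    [IsProbabilityMeasure μ] (ℱ : Filtration ℕ m) (H : ℕ → Ω → (Fin d → ℝ))
    (hA : Adapted ℱ H) (hS : ∀ N ω, H N ω ∈ stdSimplex ℝ (Fin d))
    (hM : ∀ (N : ℕ) (g : (Fin d → ℝ) → ℝ),
          μ[(fun ω => g (H (N + 1) ω))|ℱ N]
            =ᵐ[μ] fun ω => ∑ k ∈ multiIdx d n, mWeight (H N ω) k * g fun i => (k i : ℝ) / n)
    (i : Fin d) (β : ℕ) (s t : ℝ) (hs : 0 ≤ s) (hst : s < t) (ht : t ≤ 1) :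
    Integrable (fun ω => (interp H n t ω - interp H n s ω) i ^ (2 * β)) μ ∧
    ∫ ω, (interp H n t ω - interp H n s ω) i ^ (2 * β) ∂μ
      ≤ ((2 * β).factorial * (2 * Real.exp (1 / 8))) * (t - s) ^ β := by
  have hn' : (0:ℝ) < n := by exact_mod_cast hn
  have hδ : 0 < t - s := by linarith
  have hm : ∀ N, Measurable (fun ω => H N ω i) := fun N =>
    ((measurable_pi_apply i).comp (hA N)).mono (ℱ.le N) le_rfl
  have hb : ∀ N ω, |H N ω i| ≤ 1 := by
    intro N ω
    rw [abs_of_nonneg ((hS N ω).1 i), ← (hS N ω).2]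
    exact Finset.single_le_sum (fun j _ => (hS N ω).1 j) (Finset.mem_univ i)
  set b : ℕ → ℝ := fun N => cCoef (n * t) N - cCoef (n * s) N with hbdef
  have hfl : ∀ r : ℝ, r ≤ 1 → ⌊(n:ℝ) * r⌋₊ < n + 1 := by
    intro r hr
    have : ⌊(n:ℝ) * r⌋₊ ≤ n := Nat.floor_le_of_le (mul_le_of_le_one_right hn'.le hr)
    omega
  have hz : ∀ r : ℝ, 0 ≤ r → 0 ≤ (n:ℝ) * r := fun r hr => mul_nonneg hn'.le hr
  let Y : Ω → ℝ := fun ω => ∑ N ∈ Finset.range (n + 1), b N * (H (N + 1) ω i - H N ω i)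
  have hY : ∀ ω, (interp H n t ω - interp H n s ω) i = Y ω := by
    intro ω
    have e1 := aux_interp (fun N => H N ω i) (n * t) (hz t (by linarith)) (n + 1) (hfl t ht)
    have e2 := aux_interp (fun N => H N ω i) (n * s) (hz s hs) (n + 1) (hfl s (by linarith))
    simp only [interp, Pi.sub_apply, Pi.add_apply, Pi.smul_apply, smul_eq_mul]
    rw [e1, e2, add_sub_add_left_eq_sub, ← Finset.sum_sub_distrib]
    exact Finset.sum_congr rfl fun N _ => by simp only [hbdef]; ring
  have hbsum : ∑ N ∈ Finset.range (n + 1), b N = n * (t - s) := by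
    have e1 := aux_interp (fun N => (N:ℝ)) (n * t) (hz t (by linarith)) (n + 1) (hfl t ht)
    have e2 := aux_interp (fun N => (N:ℝ)) (n * s) (hz s hs) (n + 1) (hfl s (by linarith))
    push_cast at e1 e2
    simp only [add_sub_cancel_left, mul_one, zero_add, add_sub_cancel] at e1 e2
    simp only [hbdef]
    rw [Finset.sum_sub_distrib, ← e1, ← e2]; ring
  have hb01 : ∀ N, 0 ≤ b N ∧ b N ≤ 1 := by
    intro N
    have h1 := cCoef_mono (mul_le_mul_of_nonneg_left hst.le hn'.le) N
    have h2 := cCoef_mem (n * t) N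
    have h3 := cCoef_mem (n * s) N
    simp only [hbdef]
    constructor <;> linarith
  have hYm : Measurable Y :=
    Finset.measurable_fun_sum _ fun N _ => ((hm (N + 1)).sub (hm N)).const_mul _
  let B : ℝ := ∑ N ∈ Finset.range (n + 1), |b N| * 2
  have hYB : ∀ ω, |Y ω| ≤ B := by
    intro ω
    refine (Finset.abs_sum_le_sum_abs _ _).trans (Finset.sum_le_sum fun N _ => ?_)
    rw [abs_mul]
    gcongr
    have := abs_le.1 (hb N ω); have := abs_le.1 (hb (N+1) ω)
    rw [abs_le]; constructor <;> linarith
  have hint1 : Integrable (fun ω => Y ω ^ (2 * β)) μ := by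
    refine aux_bdd_integrable μ _ (hYm.pow_const _) (B ^ (2 * β)) fun ω => ?_
    rw [abs_pow]
    exact pow_le_pow_left₀ (abs_nonneg _) (hYB ω) _
  have hint2 : ∀ c : ℝ, Integrable (fun ω => Real.exp (c * Y ω)) μ := by
    intro c
    refine aux_bdd_integrable μ _ (Real.measurable_exp.comp (hYm.const_mul c))
      (Real.exp (|c| * B)) fun ω => ?_
    rw [abs_of_pos (Real.exp_pos _)]
    refine Real.exp_le_exp.2 ((le_abs_self _).trans ?_)
    rw [abs_mul]
    exact mul_le_mul_of_nonneg_left (hYB ω) (abs_nonneg _)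
  have hexp : ∀ c : ℝ, c ^ 2 = (t - s)⁻¹ → ∫ ω, Real.exp (c * Y ω) ∂μ ≤ Real.exp (1 / 8) := by
    intro c hc
    have h := aux_chain hn μ ℱ H hA hS hM i (fun N => c * b N) (n + 1)
    have e : ∀ ω, ∑ N ∈ Finset.range (n + 1), c * b N * (H (N + 1) ω i - H N ω i) = c * Y ω := by
      intro ω
      simp only [Y]
      rw [Finset.mul_sum]
      exact Finset.sum_congr rfl fun N _ => by ring
    simp only [e] at h
    refine h.trans (Real.exp_le_exp.2 ?_)
    calc ∑ N ∈ Finset.range (n + 1), (c * b N) ^ 2 / (8 * n)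
        ≤ ∑ N ∈ Finset.range (n + 1), ((t - s)⁻¹ / (8 * n)) * b N := by
          refine Finset.sum_le_sum fun N _ => ?_
          rw [mul_pow, hc, mul_div_right_comm]
          gcongr
          obtain ⟨h1, h2⟩ := hb01 N
          nlinarith
      _ = 1 / 8 := by
          rw [← Finset.mul_sum, hbsum]; field_simp
  simp only [hY]
  refine ⟨hint1, ?_⟩
  set c : ℝ := √((t - s)⁻¹) with hcdef
  have hc2 : c ^ 2 = (t - s)⁻¹ := Real.sq_sqrt (inv_nonneg.2 hδ.le)
  have hpt : ∀ ω, Y ω ^ (2 * β) ≤ (t - s) ^ β * (((2 * β).factorial : ℝ) *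
      (Real.exp (c * Y ω) + Real.exp ((-c) * Y ω))) := by
    intro ω
    have h := aux_cosh β (c * Y ω)
    rw [← neg_mul] at h
    refine le_trans (le_of_eq ?_) (mul_le_mul_of_nonneg_left h (pow_nonneg hδ.le β))
    rw [mul_pow, pow_mul c, hc2, ← mul_assoc, ← mul_pow, mul_inv_cancel₀ hδ.ne', one_pow, one_mul]
  have hi2 : Integrable (fun ω => (t - s) ^ β * (((2 * β).factorial : ℝ) *
      (Real.exp (c * Y ω) + Real.exp ((-c) * Y ω)))) μ :=
    (((hint2 c).add (hint2 (-c))).const_mul _).const_mul _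
  refine (integral_mono hint1 hi2 hpt).trans ?_
  rw [integral_const_mul, integral_const_mul, integral_add (hint2 c) (hint2 (-c)), mul_comm]
  gcongr
  have h1 := hexp c hc2
  have h2 := hexp (-c) (by rw [neg_sq, hc2])
  linarith

/-- for every `d ≥ 2` and `β ≥ 1` there is a constant `C > 0`,
independent of `n`, such that for every `n ≥ 1`, every `x ∈ Δ_{d−1}`, and every
realization of the Markov chain `{H_n^N(x)}_N` with multinomial transitions started
at `x`, the linearly interpolated process satisfies
`𝔼[‖𝓗_t^{(n)}(x) − 𝓗_s^{(n)}(x)‖^{2β}] ≤ C·(t − s)^β` for all `0 ≤ s ≤ t ≤ 1`. -/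
theorem interpolated_chain_increment_moment (d : ℕ) (hd : 2 ≤ d) (β : ℕ) (hβ : 1 ≤ β) :
    ∃ C : ℝ, 0 < C ∧
      ∀ (n : ℕ), 1 ≤ n → ∀ x ∈ stdSimplex ℝ (Fin d),
      ∀ (Ω : Type) (m : MeasurableSpace Ω) (μ : Measure Ω),
        IsProbabilityMeasure μ →
      ∀ (ℱ : Filtration ℕ m) (H : ℕ → Ω → (Fin d → ℝ)),
        Adapted ℱ H →
        (∀ ω, H 0 ω = x) →
        (∀ N ω, H N ω ∈ stdSimplex ℝ (Fin d)) →
        (∀ (N : ℕ) (g : (Fin d → ℝ) → ℝ),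
          μ[(fun ω => g (H (N + 1) ω))|ℱ N]
            =ᵐ[μ] fun ω => ∑ k ∈ multiIdx d n, mWeight (H N ω) k * g fun i => (k i : ℝ) / n) →
      ∀ s t : ℝ, 0 ≤ s → s ≤ t → t ≤ 1 →
        ∫ ω, (eucNorm (interp H n t ω - interp H n s ω)) ^ (2 * β) ∂μ
          ≤ C * (t - s) ^ β := by
  have hd0 : (0:ℝ) < d := by exact_mod_cast (by omega : 0 < d)
  refine ⟨(d : ℝ) ^ (β - 1) * (d * ((2 * β).factorial * (2 * Real.exp (1 / 8)))),
    by positivity, ?_⟩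
  intro n hn x _ Ω m μ hμ ℱ H hA _ hS hM s t hs hst ht
  rcases hst.eq_or_lt with rfl | hst
  · have h1 : β ≠ 0 := by omega
    simp [eucNorm, h1]
  have hc := fun i => aux_coord hn μ ℱ H hA hS hM i β s t hs hst ht
  have hi : Integrable (fun ω => (d : ℝ) ^ (β - 1) *
      ∑ i, (interp H n t ω - interp H n s ω) i ^ (2 * β)) μ :=
    (integrable_finsetSum _ fun i _ => (hc i).1).const_mul _
  refine (integral_mono_of_nonneg (Eventually.of_forall fun ω => ?_) hi
    (Eventually.of_forall fun ω => aux_norm hβ _)).trans ?_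
  · exact pow_nonneg (Real.sqrt_nonneg _) _
  rw [integral_const_mul, integral_finsetSum _ fun i _ => (hc i).1, mul_assoc]
  gcongr
  refine (Finset.sum_le_sum fun i _ => (hc i).2).trans (le_of_eq ?_)
  simp [mul_assoc]
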